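/- Let Qx ≥ p be a box-TDI system (Q an integral m×n matrix, p ∈ ℤ^m), and let f' : {1,…,n} → ℚ ∪ {−∞} and g' : {1,…,n} → ℚ ∪ {+∞} be rational bounding vectors with f' ≤ g' (constraints with infinite bound being omitted). Then the system [Qx ≥ p, f' ≤ x ≤ g'] is also box-TDI, and hence TDI. -/

import Mathlib

open Matrix

/-- A rational linear system `A x ≥ b` is totally dual integral (TDI): for every integral
cost vector `c` for which the dual program `max {y b : y ≥ 0, y A = c}` is feasible and
bounded, the maximum is attained by an integral vector `y`. -/
def IsTDI {ι κ : Type} [Fintype ι] [Fintype κ] (A : Matrix ι κ ℚ) (b : ι → ℚ) : Prop :=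
  ∀ c : κ → ℤ,
    (∃ y : ι → ℚ, 0 ≤ y ∧ y ᵥ* A = fun j => (c j : ℚ)) →
    (∃ M : ℚ, ∀ y : ι → ℚ, 0 ≤ y → (y ᵥ* A = fun j => (c j : ℚ)) → y ⬝ᵥ b ≤ M) →
    ∃ y : ι → ℚ, (∀ i, ∃ z : ℤ, y i = z) ∧ 0 ≤ y ∧ (y ᵥ* A = fun j => (c j : ℚ)) ∧
      ∀ y' : ι → ℚ, 0 ≤ y' → (y' ᵥ* A = fun j => (c j : ℚ)) → y' ⬝ᵥ b ≤ y ⬝ᵥ b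

/-- The coefficient matrix of the system `[A x ≥ b, x ≥ f, -x ≥ -g]`. -/
def boxMatrix {ι κ : Type} [DecidableEq κ] (A : Matrix ι κ ℚ) : Matrix (ι ⊕ (κ ⊕ κ)) κ ℚ :=
  Matrix.of fun i j =>
    match i with
    | Sum.inl i => A i j
    | Sum.inr (Sum.inl i) => if i = j then 1 else 0
    | Sum.inr (Sum.inr i) => if i = j then -1 else 0

/-- The right-hand side of the system `[A x ≥ b, x ≥ f, -x ≥ -g]`. -/
def boxRHS {ι κ : Type} (b : ι → ℚ) (f g : κ → ℚ) : ι ⊕ (κ ⊕ κ) → ℚ :=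
  Sum.elim b (Sum.elim f fun j => -(g j))

/-- A rational linear system `A x ≥ b` is box-TDI: for all rational finite-valued
bounding vectors `f ≤ g`, the system `[A x ≥ b, f ≤ x ≤ g]` is TDI. -/
def IsBoxTDI {ι κ : Type} [Fintype ι] [Fintype κ] [DecidableEq κ]
    (A : Matrix ι κ ℚ) (b : ι → ℚ) : Prop :=
  ∀ f g : κ → ℚ, f ≤ g → IsTDI (boxMatrix A) (boxRHS b f g)

/-- The coefficient matrix of the system `[Q x ≥ p, x_j ≥ f'_j (j ∈ L), -x_j ≥ -g'_j (j ∈ U)]`,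
where `L` (resp. `U`) is the set of indices where the lower (resp. upper) bound is finite;
bound constraints with infinite bound are omitted. -/
def partialBoxMatrix {m n : ℕ} (Q : Matrix (Fin m) (Fin n) ℤ) (L U : Finset (Fin n)) :
    Matrix (Fin m ⊕ ({j // j ∈ L} ⊕ {j // j ∈ U})) (Fin n) ℚ :=
  Matrix.of fun i j =>
    match i with
    | Sum.inl i => (Q i j : ℚ)
    | Sum.inr (Sum.inl i) => if i.1 = j then 1 else 0
    | Sum.inr (Sum.inr i) => if i.1 = j then -1 else 0

/-- The corresponding right-hand side. -/
def partialBoxRHS {m n : ℕ} (p : Fin m → ℤ) (L U : Finset (Fin n)) (f' g' : Fin n → ℚ) :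
    Fin m ⊕ ({j // j ∈ L} ⊕ {j // j ∈ U}) → ℚ :=
  Sum.elim (fun i => (p i : ℚ)) (Sum.elim (fun i => f' i.1) fun i => -(g' i.1))

section Farkas

variable {ι : Type*} {W : Type*} [AddCommGroup W] [Module ℚ W]

/-- Farkas' lemma for finitely many linear functionals on a rational vector space. -/
theorem exists_nonneg_combination_of_forall_nonneg (s : Finset ι) (a : ι → W →ₗ[ℚ] ℚ)
    (b : W →ₗ[ℚ] ℚ) (h : ∀ x, (∀ i ∈ s, 0 ≤ a i x) → 0 ≤ b x) :
    ∃ u : ι → ℚ, 0 ≤ u ∧ ∀ x, b x = ∑ i ∈ s, u i * a i x := by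
  classical
  induction s using Finset.induction_on generalizing a b with
  | empty =>
    refine ⟨0, le_rfl, fun x => ?_⟩
    have h₁ := h x (by simp)
    have h₂ := h (-x) (by simp)
    rw [map_neg] at h₂
    simp only [Finset.sum_empty]
    linarith
  | insert k s hk ih =>
    by_cases hs : ∀ x, (∀ i ∈ s, 0 ≤ a i x) → 0 ≤ b x
    · obtain ⟨u, hu, hub⟩ := ih a b hs
      refine ⟨fun i => if i = k then 0 else u i, fun i => ?_, fun x => ?_⟩
      · dsimp only
        split_ifs
        exacts [le_rfl, hu i]
      · rw [Finset.sum_insert hk, hub x]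
        simp only [if_true, zero_mul, zero_add]
        refine Finset.sum_congr rfl fun i hi => ?_
        rw [if_neg (ne_of_mem_of_not_mem hi hk)]
    · push Not at hs
      obtain ⟨x₁, hx₁, hbx₁⟩ := hs
      have hax₁ : a k x₁ < 0 := by
        by_contra! hcon
        refine absurd (h x₁ fun i hi => ?_) (not_le.2 hbx₁)
        rcases Finset.mem_insert.1 hi with rfl | hi
        exacts [hcon, hx₁ i hi]
      obtain ⟨x₀, hx₀, hbx₀, hax₀⟩ :
          ∃ x₀, (∀ i ∈ s, 0 ≤ a i x₀) ∧ b x₀ < 0 ∧ a k x₀ = -1 := by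
        have hpos : 0 < (-a k x₁)⁻¹ := inv_pos.2 (neg_pos.2 hax₁)
        refine ⟨(-a k x₁)⁻¹ • x₁, fun i hi => ?_, ?_, ?_⟩
        · rw [map_smul, smul_eq_mul]
          exact mul_nonneg hpos.le (hx₁ i hi)
        · rw [map_smul, smul_eq_mul]
          exact mul_neg_of_pos_of_neg hpos hbx₁
        · rw [map_smul, smul_eq_mul]
          field_simp [hax₁.ne]
      obtain ⟨u, hu, hub⟩ := ih (fun i => a i + a i x₀ • a k) (b + b x₀ • a k) fun x hx => by
        have := h (x + a k x • x₀) fun i hi => by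
          rcases Finset.mem_insert.1 hi with rfl | hi
          · simp [hax₀]
          · have := hx i hi
            simp only [LinearMap.add_apply, LinearMap.smul_apply, smul_eq_mul] at this
            rw [map_add, map_smul, smul_eq_mul]
            linarith
        rw [map_add, map_smul, smul_eq_mul] at this
        simp only [LinearMap.add_apply, LinearMap.smul_apply, smul_eq_mul]
        linarith
      refine ⟨fun i => if i = k then ∑ i ∈ s, u i * a i x₀ - b x₀ else u i, fun i => ?_,
        fun x => ?_⟩
      · dsimp only
        split_ifs
        · have := Finset.sum_nonneg fun i hi => mul_nonneg (hu i) (hx₀ i hi)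
          simp only [Pi.zero_apply]
          linarith
        · exact hu i
      · have hx := hub x
        simp only [LinearMap.add_apply, LinearMap.smul_apply, smul_eq_mul, mul_add,
          Finset.sum_add_distrib] at hx
        rw [Finset.sum_insert hk]
        dsimp only
        rw [if_pos rfl, sub_mul, Finset.sum_mul]
        have h₁ : ∑ i ∈ s, (if i = k then ∑ i ∈ s, u i * a i x₀ - b x₀ else u i) * a i x =
            ∑ i ∈ s, u i * a i x :=
          Finset.sum_congr rfl fun i hi => by rw [if_neg (ne_of_mem_of_not_mem hi hk)]
        have h₂ : ∑ i ∈ s, u i * a i x₀ * a k x = ∑ i ∈ s, u i * (a i x₀ * a k x) :=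
          Finset.sum_congr rfl fun i _ => mul_assoc _ _ _
        rw [h₁, h₂]
        linarith

end Farkas

section LinearProgramming

variable {ι κ : Type*} [Fintype ι]

/-- A feasible dual program with an improving ray is unbounded. -/
theorem not_bounded_of_improving_ray {A : Matrix ι κ ℚ} {b : ι → ℚ} {c : κ → ℚ} {y d : ι → ℚ}
    (hy : 0 ≤ y) (hyA : y ᵥ* A = c) (hd : 0 ≤ d) (hdA : d ᵥ* A = 0) (hdb : 0 < d ⬝ᵥ b) (M : ℚ) :
    ¬ ∀ y : ι → ℚ, 0 ≤ y → y ᵥ* A = c → y ⬝ᵥ b ≤ M := by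
  intro hM
  have hyM := hM y hy hyA
  have ht : 0 ≤ (M - y ⬝ᵥ b + 1) / (d ⬝ᵥ b) := div_nonneg (by linarith) hdb.le
  have := hM (y + ((M - y ⬝ᵥ b + 1) / (d ⬝ᵥ b)) • d) (add_nonneg hy (smul_nonneg ht hd))
    (by rw [add_vecMul, smul_vecMul, hdA, hyA, smul_zero, add_zero])
  rw [add_dotProduct, smul_dotProduct, smul_eq_mul, div_mul_cancel₀ _ hdb.ne'] at this
  linarith

/-- Strong linear programming duality with attainment on both sides, over `ℚ`. -/
theorem exists_primal_dual_pair [Fintype κ] {A : Matrix ι κ ℚ} {b : ι → ℚ} {c : κ → ℚ}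
    (hfeas : ∃ y : ι → ℚ, 0 ≤ y ∧ y ᵥ* A = c)
    (hbdd : ∃ M : ℚ, ∀ y : ι → ℚ, 0 ≤ y → y ᵥ* A = c → y ⬝ᵥ b ≤ M) :
    ∃ (x : κ → ℚ) (y : ι → ℚ), b ≤ A *ᵥ x ∧ 0 ≤ y ∧ y ᵥ* A = c ∧ c ⬝ᵥ x ≤ y ⬝ᵥ b := by
  classical
  obtain ⟨y₀, hy₀, hy₀A⟩ := hfeas
  obtain ⟨M, hM⟩ := hbdd
  by_contra! hno
  let pX : ((κ → ℚ) × (ι → ℚ) × ℚ) →ₗ[ℚ] (κ → ℚ) := LinearMap.fst ℚ _ _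
  let pY : ((κ → ℚ) × (ι → ℚ) × ℚ) →ₗ[ℚ] (ι → ℚ) :=
    LinearMap.fst ℚ _ _ ∘ₗ LinearMap.snd ℚ _ _
  let pT : ((κ → ℚ) × (ι → ℚ) × ℚ) →ₗ[ℚ] ℚ := LinearMap.snd ℚ _ _ ∘ₗ LinearMap.snd ℚ _ _
  let primal : ι → ((κ → ℚ) × (ι → ℚ) × ℚ) →ₗ[ℚ] ℚ := fun i =>
    LinearMap.proj i ∘ₗ A.mulVecLin ∘ₗ pX - b i • pT
  let dual : κ → ((κ → ℚ) × (ι → ℚ) × ℚ) →ₗ[ℚ] ℚ := fun j =>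
    LinearMap.proj j ∘ₗ A.vecMulLinear ∘ₗ pY - c j • pT
  let gap : ((κ → ℚ) × (ι → ℚ) × ℚ) →ₗ[ℚ] ℚ :=
    dotProductBilin ℚ ℚ b ∘ₗ pY - dotProductBilin ℚ ℚ c ∘ₗ pX
  let a : ι ⊕ ι ⊕ κ ⊕ κ ⊕ Unit → ((κ → ℚ) × (ι → ℚ) × ℚ) →ₗ[ℚ] ℚ :=
    Sum.elim primal (Sum.elim (fun i => LinearMap.proj i ∘ₗ pY)
      (Sum.elim dual (Sum.elim (fun j => -dual j) fun _ => gap)))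
  have hprimal : ∀ i x y τ, primal i (x, y, τ) = (A *ᵥ x) i - b i * τ := fun _ _ _ _ => rfl
  have hdual : ∀ j x y τ, dual j (x, y, τ) = (y ᵥ* A) j - c j * τ := fun _ _ _ _ => rfl
  have hgap : ∀ x y τ, gap (x, y, τ) = b ⬝ᵥ y - c ⬝ᵥ x := fun _ _ _ => rfl
  have hpY : ∀ i x y τ, (LinearMap.proj i ∘ₗ pY : _ →ₗ[ℚ] ℚ) (x, y, τ) = y i :=
    fun _ _ _ _ => rfl
  have hpT : ∀ x y τ, pT (x, y, τ) = τ := fun _ _ _ => rfl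
  obtain ⟨u, hu, hub⟩ := exists_nonneg_combination_of_forall_nonneg Finset.univ a (-pT) (by
    rintro ⟨x, y, τ⟩ h
    rw [LinearMap.neg_apply, hpT]
    by_contra! hτ
    replace hτ : 0 < τ := by linarith
    have h₁ : ∀ i, b i * τ ≤ (A *ᵥ x) i := fun i =>
      sub_nonneg.1 ((hprimal i x y τ) ▸ h (.inl i) (Finset.mem_univ _))
    have h₂ : 0 ≤ y := fun i => h (.inr (.inl i)) (Finset.mem_univ _)
    have h₃ : ∀ j, 0 ≤ (y ᵥ* A) j - c j * τ := fun j =>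
      h (.inr (.inr (.inl j))) (Finset.mem_univ _)
    have h₄ : ∀ j, 0 ≤ -((y ᵥ* A) j - c j * τ) := fun j =>
      h (.inr (.inr (.inr (.inl j)))) (Finset.mem_univ _)
    have h₅ : 0 ≤ b ⬝ᵥ y - c ⬝ᵥ x := h (.inr (.inr (.inr (.inr ())))) (Finset.mem_univ _)
    refine absurd (hno (τ⁻¹ • x) (τ⁻¹ • y) (fun i => ?_)
      (smul_nonneg (inv_pos.2 hτ).le h₂) (funext fun j => ?_)) (not_lt.2 ?_)
    · rw [mulVec_smul, Pi.smul_apply, smul_eq_mul, inv_mul_eq_div, le_div_iff₀ hτ]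
      exact h₁ i
    · rw [smul_vecMul, Pi.smul_apply, smul_eq_mul, inv_mul_eq_div, div_eq_iff hτ.ne']
      linarith [h₃ j, h₄ j]
    · rw [smul_dotProduct, dotProduct_smul, dotProduct_comm y b, smul_eq_mul, smul_eq_mul]
      exact mul_le_mul_of_nonneg_left (by linarith) (inv_pos.2 hτ).le)
  set v : ι → ℚ := fun i => u (.inl i)
  set r : ι → ℚ := fun i => u (.inr (.inl i))
  set z : κ → ℚ := fun j => u (.inr (.inr (.inr (.inl j)))) - u (.inr (.inr (.inl j))) with hz
  set t : ℚ := u (.inr (.inr (.inr (.inr ()))))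
  have hv0 : 0 ≤ v := fun i => hu _
  have hr0 : 0 ≤ r := fun i => hu _
  have ht0 : 0 ≤ t := hu _
  have key : ∀ x y τ, -τ = (v ⬝ᵥ (A *ᵥ x) - v ⬝ᵥ b * τ) + r ⬝ᵥ y
      - (y ᵥ* A ⬝ᵥ z - c ⬝ᵥ z * τ) + t * (b ⬝ᵥ y - c ⬝ᵥ x) := by
    intro x y τ
    have := hub (x, y, τ)
    simp only [a, LinearMap.neg_apply, hpT, Fintype.sum_sum_type, Sum.elim_inl, Sum.elim_inr,
      hprimal, hdual, hgap, hpY, Finset.univ_unique, Finset.sum_singleton] at this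
    have h₁ : ∑ i, v i * ((A *ᵥ x) i - b i * τ) = v ⬝ᵥ (A *ᵥ x) - v ⬝ᵥ b * τ := by
      simp only [dotProduct, mul_sub, Finset.sum_sub_distrib, Finset.sum_mul, mul_assoc]
    have h₂ : ∑ j, u (.inr (.inr (.inl j))) * ((y ᵥ* A) j - c j * τ) +
        ∑ j, u (.inr (.inr (.inr (.inl j)))) * -((y ᵥ* A) j - c j * τ) =
        -(y ᵥ* A ⬝ᵥ z - c ⬝ᵥ z * τ) := by
      simp only [dotProduct, Finset.sum_mul, ← Finset.sum_sub_distrib, ← Finset.sum_neg_distrib,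
        ← Finset.sum_add_distrib]
      refine Finset.sum_congr rfl fun j _ => ?_
      simp only [hz]
      ring
    change -τ = ∑ i, v i * _ + (r ⬝ᵥ y + (_ + (_ + t * _))) at this
    rw [h₁] at this
    linear_combination this + h₂
  have hx : ∀ x, v ⬝ᵥ (A *ᵥ x) = t * c ⬝ᵥ x := fun x => by
    have := key x 0 0
    simp at this
    linarith
  have hy : ∀ y, y ᵥ* A ⬝ᵥ z = r ⬝ᵥ y + t * b ⬝ᵥ y := fun y => by
    have := key 0 y 0
    simp at this
    linarith
  have hτ : v ⬝ᵥ b = 1 + c ⬝ᵥ z := by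
    have := key 0 0 1
    simp at this
    linarith
  rcases ht0.eq_or_lt with ht0 | ht0
  · rw [← ht0] at hx hy
    have hvA : v ᵥ* A = 0 := by
      refine dotProduct_eq_zero_iff.1 fun x => ?_
      rw [← dotProduct_mulVec, hx, zero_mul]
    have hcz := hy y₀
    rw [hy₀A] at hcz
    have := dotProduct_nonneg_of_nonneg hr0 hy₀
    exact not_bounded_of_improving_ray hy₀ hy₀A hv0 hvA (by linarith) M hM
  · have h₁ := hy v
    rw [← dotProduct_mulVec, hx, dotProduct_comm b v] at h₁
    have h₂ := dotProduct_nonneg_of_nonneg hr0 hv0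
    have h₃ : v ⬝ᵥ b ≤ c ⬝ᵥ z := le_of_mul_le_mul_left (by linarith) ht0
    linarith

end LinearProgramming

section Pushforward

variable {ι ι' κ : Type*} [Fintype ι] [DecidableEq ι']

/-- The pushforward of a vector along a map of index sets, summing over fibres. -/
def pushVec (σ : ι → ι') (y : ι → ℚ) (k : ι') : ℚ := ∑ i, if σ i = k then y i else 0

theorem pushVec_nonneg (σ : ι → ι') {y : ι → ℚ} (hy : 0 ≤ y) : 0 ≤ pushVec σ y :=
  fun k => Finset.sum_nonneg fun i _ => by
    split_ifs
    exacts [hy i, le_rfl]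

theorem pushVec_dotProduct [Fintype ι'] (σ : ι → ι') (y : ι → ℚ) (h : ι' → ℚ) :
    pushVec σ y ⬝ᵥ h = y ⬝ᵥ (h ∘ σ) := by
  simp only [pushVec, dotProduct, Finset.sum_mul, Function.comp_apply]
  rw [Finset.sum_comm]
  refine Finset.sum_congr rfl fun i _ => ?_
  simp

theorem pushVec_vecMul [Fintype ι'] (σ : ι → ι') (y : ι → ℚ) (A : Matrix ι' κ ℚ) :
    pushVec σ y ᵥ* A = y ᵥ* A.submatrix σ id :=
  funext fun j => pushVec_dotProduct σ y fun i => A i j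

theorem pushVec_integral (σ : ι → ι') {y : ι → ℚ} (hy : ∀ i, ∃ z : ℤ, y i = z) (k : ι') :
    ∃ z : ℤ, pushVec σ y k = z := by
  choose w hw using hy
  refine ⟨∑ i, if σ i = k then w i else 0, ?_⟩
  simp [pushVec, hw]

end Pushforward

section TDI

variable {ι ι' κ : Type} [Fintype ι] [Fintype ι'] [Fintype κ]

/-- Total dual integrality is preserved when rows are duplicated with weaker right-hand sides. -/
theorem IsTDI.of_duplicate_rows [DecidableEq ι] [DecidableEq ι'] {A : Matrix ι κ ℚ} {b : ι → ℚ}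
    (h : IsTDI A b) {A' : Matrix ι' κ ℚ} {b' : ι' → ℚ} (σ : ι' → ι) (τ : ι → ι')
    (hσA : A.submatrix σ id = A') (hσb : b' ≤ b ∘ σ)
    (hτA : A'.submatrix τ id = A) (hτb : b' ∘ τ = b) : IsTDI A' b' := by
  rintro c ⟨y₀, hy₀, hy₀A⟩ ⟨M, hM⟩
  obtain ⟨y, hyint, hy, hyA, hopt⟩ := h c
    ⟨pushVec σ y₀, pushVec_nonneg σ hy₀, by rw [pushVec_vecMul, hσA, hy₀A]⟩
    ⟨M, fun y hy hyA => by
      have := hM (pushVec τ y) (pushVec_nonneg τ hy) (by rw [pushVec_vecMul, hτA, hyA])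
      rwa [pushVec_dotProduct, hτb] at this⟩
  refine ⟨pushVec τ y, pushVec_integral τ hyint, pushVec_nonneg τ hy,
    by rw [pushVec_vecMul, hτA, hyA], fun y' hy' hy'A => ?_⟩
  rw [pushVec_dotProduct, hτb]
  refine le_trans ?_ (hopt (pushVec σ y') (pushVec_nonneg σ hy')
    (by rw [pushVec_vecMul, hσA, hy'A]))
  rw [pushVec_dotProduct]
  exact dotProduct_le_dotProduct_of_nonneg_left hσb hy'

theorem isTDI_of_improving_ray {A : Matrix ι κ ℚ} {b d : ι → ℚ} (hd : 0 ≤ d)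
    (hdA : d ᵥ* A = 0) (hdb : 0 < d ⬝ᵥ b) : IsTDI A b := by
  rintro c ⟨y, hy, hyA⟩ ⟨M, hM⟩
  exact absurd hM (not_bounded_of_improving_ray hy hyA hd hdA hdb M)

theorem vecMul_boxMatrix [DecidableEq κ] (A : Matrix ι κ ℚ) (y : ι → ℚ) (v w : κ → ℚ) :
    Sum.elim y (Sum.elim v w) ᵥ* boxMatrix A = y ᵥ* A + v - w := by
  ext j
  simp [vecMul, dotProduct, boxMatrix, sub_eq_add_neg, add_assoc]

theorem dotProduct_boxRHS (y b : ι → ℚ) (v w f g : κ → ℚ) :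
    Sum.elim y (Sum.elim v w) ⬝ᵥ boxRHS b f g = y ⬝ᵥ b + v ⬝ᵥ f - w ⬝ᵥ g := by
  simp [dotProduct, boxRHS, sub_eq_add_neg, add_assoc]

/-- A box-TDI system is TDI. -/
theorem IsBoxTDI.isTDI [DecidableEq κ] {A : Matrix ι κ ℚ} {b : ι → ℚ} (h : IsBoxTDI A b) :
    IsTDI A b := by
  intro c hfeas hbdd
  obtain ⟨x, y₀, hx, hy₀, hy₀A, hgap⟩ := exists_primal_dual_pair hfeas hbdd
  set c' : κ → ℚ := fun j => (c j : ℚ)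
  have weak : ∀ y : ι → ℚ, 0 ≤ y → y ⬝ᵥ b ≤ y ᵥ* A ⬝ᵥ x := fun y hy => by
    rw [← dotProduct_mulVec]
    exact dotProduct_le_dotProduct_of_nonneg_left hx hy
  have weakBox : ∀ (y : ι → ℚ) (v w : κ → ℚ), 0 ≤ y →
      Sum.elim y (Sum.elim v w) ᵥ* boxMatrix A = c' →
      Sum.elim y (Sum.elim v w) ⬝ᵥ boxRHS b (x - 1) (x + 1) ≤ c' ⬝ᵥ x - v ⬝ᵥ 1 - w ⬝ᵥ 1 := by
    intro y v w hy hA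
    rw [vecMul_boxMatrix] at hA
    rw [dotProduct_boxRHS, ← hA, sub_dotProduct, add_dotProduct, dotProduct_sub, dotProduct_add]
    linarith [weak y hy]
  have hsplit : ∀ Y : ι ⊕ (κ ⊕ κ) → ℚ, ∃ y v w, Y = Sum.elim y (Sum.elim v w) := fun Y =>
    ⟨fun i => Y (.inl i), fun j => Y (.inr (.inl j)), fun j => Y (.inr (.inr j)), by
      ext (i | i | i) <;> rfl⟩
  have hone : ∀ v : κ → ℚ, 0 ≤ v → 0 ≤ v ⬝ᵥ 1 := fun v hv =>
    dotProduct_nonneg_of_nonneg hv zero_le_one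
  have hzero : ∀ v : κ → ℚ, 0 ≤ v → v ⬝ᵥ 1 ≤ 0 → v = 0 := fun v hv hv1 => by
    rw [dotProduct_one] at hv1
    exact (Fintype.sum_eq_zero_iff_of_nonneg hv).1
      (le_antisymm hv1 (Finset.sum_nonneg fun i _ => hv i))
  have extA : Sum.elim y₀ (Sum.elim (0 : κ → ℚ) 0) ᵥ* boxMatrix A = c' := by
    rw [vecMul_boxMatrix, hy₀A, add_zero, sub_zero]
  have ext0 : 0 ≤ Sum.elim y₀ (Sum.elim (0 : κ → ℚ) (0 : κ → ℚ)) := by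
    rintro (i | i | i)
    exacts [hy₀ i, le_rfl, le_rfl]
  obtain ⟨Y, hYint, hY, hYA, hopt⟩ := h (x - 1) (x + 1)
    (fun j => by simp only [Pi.sub_apply, Pi.add_apply, Pi.one_apply]; linarith) c
    ⟨_, ext0, extA⟩ ⟨c' ⬝ᵥ x, fun Y hY hYA => by
      obtain ⟨y, v, w, rfl⟩ := hsplit Y
      have := weakBox y v w (fun i => hY (.inl i)) hYA
      have hv := hone v fun j => hY (.inr (.inl j))
      have hw := hone w fun j => hY (.inr (.inr j))
      linarith⟩
  obtain ⟨y, v, w, rfl⟩ := hsplit Y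
  have hy : 0 ≤ y := fun i => hY (.inl i)
  have hv : 0 ≤ v := fun j => hY (.inr (.inl j))
  have hw : 0 ≤ w := fun j => hY (.inr (.inr j))
  have h₁ := weakBox y v w hy hYA
  have h₂ := hopt _ ext0 extA
  rw [dotProduct_boxRHS, zero_dotProduct, zero_dotProduct] at h₂
  have hv1 := hone v hv
  have hw1 := hone w hw
  obtain rfl : v = 0 := hzero v hv (by linarith)
  obtain rfl : w = 0 := hzero w hw (by linarith)
  rw [vecMul_boxMatrix, add_zero, sub_zero] at hYA
  rw [dotProduct_boxRHS] at h₂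
  simp only [zero_dotProduct] at h₂
  refine ⟨y, fun i => hYint (.inl i), hy, hYA, fun y' hy' hy'A => ?_⟩
  have h₃ := weak y' hy'
  rw [hy'A] at h₃
  linarith

end TDI

theorem partialBox_isBoxTDI {m n : ℕ} {Q : Matrix (Fin m) (Fin n) ℤ} {p : Fin m → ℤ}
    (hbox : IsBoxTDI (Q.map (Int.cast : ℤ → ℚ)) fun i => (p i : ℚ))
    (L U : Finset (Fin n)) (f' g' : Fin n → ℚ) :
    IsBoxTDI (partialBoxMatrix Q L U) (partialBoxRHS p L U f' g') := by
  intro f g _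
  let F : Fin n → ℚ := fun j => if j ∈ L ∧ f j < f' j then f' j else f j
  let G : Fin n → ℚ := fun j => if j ∈ U ∧ g' j < g j then g' j else g j
  let σ : (Fin m ⊕ ({j // j ∈ L} ⊕ {j // j ∈ U})) ⊕ (Fin n ⊕ Fin n) → Fin m ⊕ (Fin n ⊕ Fin n) :=
    Sum.elim (Sum.map id (Sum.map Subtype.val Subtype.val)) Sum.inr
  let τ : Fin m ⊕ (Fin n ⊕ Fin n) → (Fin m ⊕ ({j // j ∈ L} ⊕ {j // j ∈ U})) ⊕ (Fin n ⊕ Fin n) :=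
    Sum.elim (fun i => .inl (.inl i)) (Sum.elim
      (fun j => if h : j ∈ L ∧ f j < f' j then .inl (.inr (.inl ⟨j, h.1⟩)) else .inr (.inl j))
      (fun j => if h : j ∈ U ∧ g' j < g j then .inl (.inr (.inr ⟨j, h.1⟩)) else .inr (.inr j)))
  have hστ : σ ∘ τ = id := by
    ext (i | j | j)
    · rfl
    · simp only [τ, Function.comp_apply, Sum.elim_inr, Sum.elim_inl]
      split_ifs <;> rfl
    · simp only [τ, Function.comp_apply, Sum.elim_inr]
      split_ifs <;> rfl
  have hσA : (boxMatrix (Q.map (Int.cast : ℤ → ℚ))).submatrix σ id =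
      boxMatrix (partialBoxMatrix Q L U) := by
    ext ((i | i | i) | i | i) j <;> rfl
  have hτA : (boxMatrix (partialBoxMatrix Q L U)).submatrix τ id =
      boxMatrix (Q.map (Int.cast : ℤ → ℚ)) := by
    rw [← hσA, submatrix_submatrix, hστ]
    rfl
  have hτb : boxRHS (partialBoxRHS p L U f' g') f g ∘ τ = boxRHS (fun i => (p i : ℚ)) F G := by
    ext (i | j | j)
    · rfl
    · simp only [τ, F, boxRHS, partialBoxRHS, Function.comp_apply, Sum.elim_inr, Sum.elim_inl]
      split_ifs <;> rfl
    · simp only [τ, G, boxRHS, partialBoxRHS, Function.comp_apply, Sum.elim_inr]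
      split_ifs <;> rfl
  have hσb : boxRHS (partialBoxRHS p L U f' g') f g ≤
      boxRHS (fun i => (p i : ℚ)) F G ∘ σ := by
    rintro ((i | ⟨j, hj⟩ | ⟨j, hj⟩) | j | j)
    · exact le_rfl
    · change f' j ≤ F j
      grind
    · change -g' j ≤ -G j
      grind
    · change f j ≤ F j
      grind
    · change -g j ≤ -G j
      grind
  by_cases hFG : F ≤ G
  · exact (hbox F G hFG).of_duplicate_rows σ τ hσA hσb hτA hτb
  · obtain ⟨j, hj⟩ := not_forall.1 hFG
    let e : Fin m ⊕ (Fin n ⊕ Fin n) → ℚ :=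
      Sum.elim 0 (Sum.elim (Pi.single j 1) (Pi.single j 1))
    have he : 0 ≤ e := by
      have hsingle : (0 : Fin n → ℚ) ≤ Pi.single j 1 := Pi.single_nonneg.2 zero_le_one
      rintro (i | i | i)
      exacts [le_rfl, hsingle i, hsingle i]
    refine isTDI_of_improving_ray (pushVec_nonneg τ he) ?_ ?_
    · rw [pushVec_vecMul, hτA, vecMul_boxMatrix, zero_vecMul, zero_add, sub_self]
    · rw [pushVec_dotProduct, hτb, dotProduct_boxRHS, zero_dotProduct, single_one_dotProduct,
        single_one_dotProduct]
      linarith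

/-- If `Q x ≥ p` is box-TDI and `f' ≤ g'` are rational bounding vectors
possibly with `-∞` (indices outside `L`) resp. `+∞` (indices outside `U`) components
(whose constraints are omitted), then `[Q x ≥ p, f' ≤ x ≤ g']` is box-TDI, and hence TDI. -/
theorem partial_bounds_boxTDI {m n : ℕ} (Q : Matrix (Fin m) (Fin n) ℤ) (p : Fin m → ℤ)
    (hbox : IsBoxTDI (Q.map (Int.cast : ℤ → ℚ)) fun i => (p i : ℚ))
    (L U : Finset (Fin n)) (f' g' : Fin n → ℚ)
    (hfg : ∀ j, j ∈ L → j ∈ U → f' j ≤ g' j) :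
    IsBoxTDI (partialBoxMatrix Q L U) (partialBoxRHS p L U f' g') ∧
      IsTDI (partialBoxMatrix Q L U) (partialBoxRHS p L U f' g') := by
  exact ⟨partialBox_isBoxTDI hbox L U f' g', (partialBox_isBoxTDI hbox L U f' g').isTDI⟩
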